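/- Let n ≥ 2 be an integer, m > 0, δ > 0, and let h : [0, ∞) → (0, ∞) be a continuous function. Let C₅ > 0 be a constant satisfying C₅ · ∫_δ^∞ h(s) ds > (n−1)/δ (in particular, any C₅ > 0 works if ∫_δ^∞ h(s) ds = ∞). Then there exists no continuously differentiable function φ : [δ, ∞) → ℝ such that (1/m)φ(t)² + C₅ h(t) + φ′(t) ≤ 0 for all t ≥ δ and 0 ≤ φ(t) ≤ (n−1)/t for all t ≥ δ. -/

import Mathlib

/-!
The analytic core of the proof of Theorem 3 of the paper: there is no `C¹` function
`φ : [δ, ∞) → ℝ` with `(1/m) φ² + C₅ h + φ' ≤ 0` and `0 ≤ φ(t) ≤ (n-1)/t`, provided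
`C₅ ∫_δ^∞ h > (n-1)/δ`.  For the positive continuous function `h`, the condition
`∫_δ^∞ h(s) ds = ∞` is expressed as `¬ IntegrableOn h (Ioi δ)`.
-/

open Set MeasureTheory

/-- A nonnegative continuous function dominated by `-f'` on `[a, ∞)`, where `f` is nonnegative and
continuously differentiable, is integrable on `(a, ∞)` with integral at most `f a`. -/
theorem integrableOn_Ioi_and_integral_le_of_le_neg_deriv {a : ℝ} {f f' g : ℝ → ℝ}
    (hf : ∀ t ∈ Ici a, HasDerivWithinAt f (f' t) (Ici a) t) (hf' : ContinuousOn f' (Ici a))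
    (hf0 : ∀ t ∈ Ici a, 0 ≤ f t) (hg : ContinuousOn g (Ici a)) (hg0 : ∀ t ∈ Ici a, 0 ≤ g t)
    (hfg : ∀ t ∈ Ici a, g t ≤ -f' t) :
    IntegrableOn g (Ioi a) ∧ ∫ t in Ioi a, g t ≤ f a := by
  have hint {k : ℝ → ℝ} (hk : ContinuousOn k (Ici a)) {t : ℝ} (ht : a ≤ t) :
      IntervalIntegrable k volume a t :=
    (hk.mono Icc_subset_Ici_self).intervalIntegrable_of_Icc ht
  have hbound (t : ℝ) (ht : a ≤ t) : ∫ s in a..t, g s ≤ f a := by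
    have hftc : ∫ s in a..t, f' s = f t - f a :=
      intervalIntegral.integral_eq_sub_of_hasDeriv_right_of_le ht
        (fun s hs => (hf s hs.1).continuousWithinAt.mono Icc_subset_Ici_self)
        (fun s hs => (hf s hs.1.le).mono (Ioi_subset_Ici hs.1.le)) (hint hf' ht)
    have hmono : ∫ s in a..t, g s ≤ ∫ s in a..t, -f' s :=
      intervalIntegral.integral_mono_on ht (hint hg ht) (hint hf' ht).neg
        fun s hs => hfg s hs.1
    rw [intervalIntegral.integral_neg, hftc] at hmono
    linarith [hf0 t ht]
  have hgi : IntegrableOn g (Ioi a) := by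
    refine integrableOn_Ioi_of_intervalIntegral_norm_bounded (f a) a (l := Filter.atTop)
      (b := id) (fun t => ?_) Filter.tendsto_id ?_
    · exact ((hg.mono Icc_subset_Ici_self).integrableOn_Icc).mono_set Ioc_subset_Icc_self
    · filter_upwards [Filter.eventually_ge_atTop a] with t ht
      refine le_of_eq_of_le (intervalIntegral.integral_congr fun s hs => ?_) (hbound t ht)
      rw [id, uIcc_of_le ht] at hs
      exact Real.norm_of_nonneg (hg0 s hs.1)
  refine ⟨hgi, le_of_tendsto (intervalIntegral_tendsto_integral_Ioi a hgi Filter.tendsto_id) ?_⟩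
  filter_upwards [Filter.eventually_ge_atTop a] with t ht using hbound t ht

/-- Let `n ≥ 2` be an integer, `m > 0`, `δ > 0`, and `h : [0, ∞) → (0, ∞)` continuous.
Let `C₅ > 0` satisfy `C₅ · ∫_δ^∞ h(s) ds > (n-1)/δ` (in particular, any `C₅ > 0` works
if `∫_δ^∞ h(s) ds = ∞`).  Then there is no continuously differentiable
`φ : [δ, ∞) → ℝ` with `(1/m) φ(t)² + C₅ h(t) + φ'(t) ≤ 0` and `0 ≤ φ(t) ≤ (n-1)/t` for
all `t ≥ δ`. -/
theorem no_C1_solution_of_riccati_inequality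
    (n : ℕ) (hn : 2 ≤ n) (m : ℝ) (hm : 0 < m) (δ : ℝ) (hδ : 0 < δ)
    -- `h : [0, ∞) → (0, ∞)` is continuous:
    (h : ℝ → ℝ) (hcont : ContinuousOn h (Ici 0)) (hpos : ∀ s ∈ Ici (0 : ℝ), 0 < h s)
    (C₅ : ℝ) (hC₅ : 0 < C₅)
    -- `C₅ ∫_δ^∞ h > (n-1)/δ`, any `C₅ > 0` being allowed when `∫_δ^∞ h = ∞`:
    (hbig : (IntegrableOn h (Ioi δ) ∧
        ((n : ℝ) - 1) / δ < C₅ * ∫ s in Ioi δ, h s) ∨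
      ¬ IntegrableOn h (Ioi δ)) :
    ¬ ∃ φ φ' : ℝ → ℝ,
      (∀ t ∈ Ici δ, HasDerivWithinAt φ (φ' t) (Ici δ) t) ∧
      ContinuousOn φ' (Ici δ) ∧
      (∀ t ∈ Ici δ, (1 / m) * φ t ^ 2 + C₅ * h t + φ' t ≤ 0) ∧
      (∀ t ∈ Ici δ, 0 ≤ φ t ∧ φ t ≤ ((n : ℝ) - 1) / t) := by
  rintro ⟨φ, φ', hφ, hφ', hric, hbd⟩
  have hsub : Ici δ ⊆ Ici (0 : ℝ) := Ici_subset_Ici.2 hδ.le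
  obtain ⟨hint, hle⟩ := integrableOn_Ioi_and_integral_le_of_le_neg_deriv
    (g := fun t => C₅ * h t) hφ hφ' (fun t ht => (hbd t ht).1)
    (continuousOn_const.mul (hcont.mono hsub))
    (fun t ht => (mul_pos hC₅ (hpos t (hsub ht))).le)
    (fun t ht => by
      have hsq : 0 ≤ (1 / m) * φ t ^ 2 := by positivity
      linarith [hric t ht])
  rcases hbig with ⟨-, hlt⟩ | hnot
  · rw [integral_const_mul] at hle
    linarith [(hbd δ self_mem_Ici).2]
  · exact hnot ((integrable_const_mul_iff hC₅.ne'.isUnit h).1 hint)
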